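/- Let R be a local ring and let M be an invertible 3×3 matrix over R. Then: (i) for every a ∈ R³ with at least one coordinate a unit, the vector M·a has at least one coordinate a unit; (ii) if a, b ∈ R³ represent points of the projective plane over R that are apart from each other, then M·a and M·b represent points that are apart from each other; (iii) if λ ∈ R³ represents a line and λ·a = 0, then ((M⁻¹)ᵀ·λ)·(M·a) = 0; (iv) if λ·a is a unit, then ((M⁻¹)ᵀ·λ)·(M·a) is a unit. (Here λ·a denotes λ₀a₀+λ₁a₁+λ₂a₂.) -/

import Mathlib

/-- A vector in `R³` has at least one coordinate a unit, hence represents a point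
(or line) of the projective plane over `R`. -/
def IsRep {R : Type*} [CommRing R] (a : Fin 3 → R) : Prop :=
  IsUnit (a 0) ∨ IsUnit (a 1) ∨ IsUnit (a 2)

/-- The bilinear pairing between a line and a point. -/
def dot {R : Type*} [CommRing R] (l a : Fin 3 → R) : R :=
  l 0 * a 0 + l 1 * a 1 + l 2 * a 2

/-- The points (or lines) represented by `a` and `b` are apart from each other. -/
def Apart {R : Type*} [CommRing R] (a b : Fin 3 → R) : Prop :=
  IsUnit (a 0 * b 1 - a 1 * b 0) ∨ IsUnit (a 1 * b 2 - a 2 * b 1) ∨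
    IsUnit (a 2 * b 0 - a 0 * b 2)

theorem dot_eq_dotProduct {R : Type*} [CommRing R] (l a : Fin 3 → R) :
    dot l a = dotProduct l a := by
  simp [dot, dotProduct, Fin.sum_univ_three]

/-- The contragredient action on lines preserves the pairing with points. -/
theorem dot_inv_transpose_mulVec {R : Type*} [CommRing R]
    {M : Matrix (Fin 3) (Fin 3) R} (hM : IsUnit M.det) (l a : Fin 3 → R) :
    dot ((M⁻¹).transpose.mulVec l) (M.mulVec a) = dot l a := by
  rw [dot_eq_dotProduct, dot_eq_dotProduct, Matrix.mulVec_transpose, ← Matrix.dotProduct_mulVec,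
    Matrix.mulVec_mulVec, Matrix.nonsing_inv_mul M hM, Matrix.one_mulVec]

theorem IsRep.exists_isUnit_dot {R : Type*} [CommRing R] {a : Fin 3 → R} (ha : IsRep a) :
    ∃ l : Fin 3 → R, IsUnit (dot l a) := by
  simp only [dot_eq_dotProduct]
  rcases ha with h | h | h
  · exact ⟨Pi.single 0 1, by simpa using h⟩
  · exact ⟨Pi.single 1 1, by simpa using h⟩
  · exact ⟨Pi.single 2 1, by simpa using h⟩

theorem isRep_of_isUnit_dot {R : Type*} [CommRing R] [IsLocalRing R] {l a : Fin 3 → R}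
    (h : IsUnit (dot l a)) : IsRep a := by
  rcases IsLocalRing.isUnit_or_isUnit_of_isUnit_add h with h | h
  · rcases IsLocalRing.isUnit_or_isUnit_of_isUnit_add h with h | h
    · exact Or.inl (isUnit_of_mul_isUnit_right h)
    · exact Or.inr (Or.inl (isUnit_of_mul_isUnit_right h))
  · exact Or.inr (Or.inr (isUnit_of_mul_isUnit_right h))

theorem IsRep.mulVec {R : Type*} [CommRing R] [IsLocalRing R]
    {M : Matrix (Fin 3) (Fin 3) R} (hM : IsUnit M.det) {a : Fin 3 → R} (ha : IsRep a) :
    IsRep (M.mulVec a) := by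
  obtain ⟨l, hl⟩ := ha.exists_isUnit_dot
  exact isRep_of_isUnit_dot ((dot_inv_transpose_mulVec hM l a).symm ▸ hl)

theorem apart_iff_isRep_crossProduct {R : Type*} [CommRing R] (a b : Fin 3 → R) :
    Apart a b ↔ IsRep (crossProduct a b) := by
  simp only [Apart, IsRep, cross_apply, Matrix.cons_val]
  tauto

/-- The cross product transforms by the cofactor matrix. -/
theorem crossProduct_mulVec_mulVec {R : Type*} [CommRing R]
    (M : Matrix (Fin 3) (Fin 3) R) (a b : Fin 3 → R) :
    crossProduct (M.mulVec a) (M.mulVec b) =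
      M.adjugate.transpose.mulVec (crossProduct a b) := by
  ext i
  fin_cases i <;>
    simp [cross_apply, Matrix.adjugate_fin_three, Matrix.mulVec, dotProduct,
      Fin.sum_univ_three] <;>
    ring

theorem Apart.mulVec {R : Type*} [CommRing R] [IsLocalRing R]
    {M : Matrix (Fin 3) (Fin 3) R} (hM : IsUnit M.det) {a b : Fin 3 → R} (h : Apart a b) :
    Apart (M.mulVec a) (M.mulVec b) := by
  rw [apart_iff_isRep_crossProduct] at h ⊢
  rw [crossProduct_mulVec_mulVec]
  refine h.mulVec ?_
  rw [Matrix.det_transpose, Matrix.det_adjugate]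
  exact hM.pow _

open Matrix in
/-- An invertible `3 × 3` matrix over a local ring induces an automorphism of the
projective plane: it preserves representatives, apartness, incidence and non-incidence. -/
theorem matrix_induces_projective_automorphism
    {R : Type*} [CommRing R] [IsLocalRing R]
    (M : Matrix (Fin 3) (Fin 3) R) (hM : IsUnit M.det) :
    (∀ a : Fin 3 → R, IsRep a → IsRep (M.mulVec a)) ∧
    (∀ a b : Fin 3 → R, IsRep a → IsRep b → Apart a b →
      Apart (M.mulVec a) (M.mulVec b)) ∧
    (∀ a l : Fin 3 → R, IsRep a → IsRep l → dot l a = 0 →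
      dot ((M⁻¹)ᵀ.mulVec l) (M.mulVec a) = 0) ∧
    (∀ a l : Fin 3 → R, IsRep a → IsRep l → IsUnit (dot l a) →
      IsUnit (dot ((M⁻¹)ᵀ.mulVec l) (M.mulVec a))) := by
  exact ⟨fun a ha => ha.mulVec hM, fun a b _ _ h => h.mulVec hM,
    fun a l _ _ h => (dot_inv_transpose_mulVec hM l a).trans h,
    fun a l _ _ h => (dot_inv_transpose_mulVec hM l a).symm ▸ h⟩
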